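/- Fix M > 1 and τ ∈ [0,1]; let c = 2/(1 + M^{−τ}) and μ = (4/π) arctan M^{−(1−τ)/2}. Let J(t) be the rotation matrix with rows (cos t, −sin t) and (sin t, cos t); for x ≠ 0 define K_τ(x) = Id if arg x ∈ [0, cπ/2) ∪ [π, π + cπ/2) and K_τ(x) = diag(M, M^{1−2τ}) otherwise, and A_τ(x) = J(arg x) K_τ(x) J(arg x)^T. Let w_τ be the 2π-periodic function with w_τ(θ) = sin( μ(θ/c − π/4) ) for θ ∈ [0, cπ/2), w_τ(θ) = M^{−(1−τ)/2} cos( μ( M^{τ}(θ − cπ/2)/c − π/4 ) ) for θ ∈ [cπ/2, π), and w_τ(θ + π) = −w_τ(θ). Then the function u_τ defined on the unit disk B₁(0) by u_τ(x) = |x|^{μ/c} w_τ(arg x) for x ≠ 0 and u_τ(0) = 0 belongs to H¹(B₁(0)) and is a weak solution of div(A_τ ∇u) = 0 in B₁(0), i.e. ∫_{B₁(0)} ⟨A_τ ∇u_τ, ∇φ⟩ = 0 for all φ ∈ C_c^∞(B₁(0)). -/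

import Mathlib

open MeasureTheory Real Set Matrix intervalIntegral
open scoped Classical

noncomputable section

abbrev V2 := EuclideanSpace ℝ (Fin 2)

def toV (v : Fin 2 → ℝ) : V2 := (WithLp.equiv 2 (Fin 2 → ℝ)).symm v

def dot2 (v w : Fin 2 → ℝ) : ℝ := v 0 * w 0 + v 1 * w 1

def quad (A : Matrix (Fin 2) (Fin 2) ℝ) (ξ : Fin 2 → ℝ) : ℝ := dot2 ξ (A.mulVec ξ)

def eit (t : ℝ) : V2 := toV ![Real.cos t, Real.sin t]

/-- The angular polar coordinate `arg y ∈ [0, 2π)` of `y ∈ ℝ²` (with `arg 0 = 0`). -/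
def arg2 (x : V2) : ℝ :=
  if 0 ≤ Complex.arg (Complex.mk (x 0) (x 1)) then Complex.arg (Complex.mk (x 0) (x 1))
  else Complex.arg (Complex.mk (x 0) (x 1)) + 2 * π

/-- The rotation matrix `J(t)`. -/
def Jmat (t : ℝ) : Matrix (Fin 2) (Fin 2) ℝ :=
  !![Real.cos t, -Real.sin t; Real.sin t, Real.cos t]

/-- `c = 2/(1 + M^{−τ})`. -/
def cM (M τ : ℝ) : ℝ := 2 / (1 + M ^ (-τ))

/-- The piecewise-constant matrix `K_τ`: the identity on the cone
`arg x ∈ [0, cπ/2) ∪ [π, π + cπ/2)` and `diag(M, M^{1−2τ})` otherwise. -/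
def Ktau (M τ : ℝ) (x : V2) : Matrix (Fin 2) (Fin 2) ℝ :=
  if arg2 x ∈ Ico 0 (cM M τ * π / 2) ∪ Ico π (π + cM M τ * π / 2) then 1
  else Matrix.diagonal ![M, M ^ (1 - 2 * τ)]

/-- The coefficient matrix `A_τ(x) = J(arg x) K_τ(x) J(arg x)ᵀ`. -/
def Atau (M τ : ℝ) (x : V2) : Matrix (Fin 2) (Fin 2) ℝ :=
  Jmat (arg2 x) * Ktau M τ x * (Jmat (arg2 x))ᵀ

/-- `f(x, ρ) = (1/2π) ∫₀^{2π} ⟨e^{it}, A_τ(x + ρe^{it}) e^{it}⟩ / √(det A_τ(x + ρe^{it})) dt`. -/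
def ftau (M τ : ℝ) (x : V2) (ρ : ℝ) : ℝ :=
  (1 / (2 * π)) * ∫ t in (0 : ℝ)..(2 * π),
    quad (Atau M τ (x + ρ • eit t)) (eit t) / Real.sqrt ((Atau M τ (x + ρ • eit t)).det)

/-- `μ = (4/π) arctan M^{−(1−τ)/2}`. -/
def muM (M τ : ℝ) : ℝ := (4 / π) * arctan (M ^ (-(1 - τ) / 2))

/-- The profile `w_τ` on `[0, π)`. -/
def wbase (M τ : ℝ) (θ : ℝ) : ℝ :=
  if θ < cM M τ * π / 2 then Real.sin (muM M τ * (θ / cM M τ - π / 4))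
  else M ^ (-(1 - τ) / 2) *
    Real.cos (muM M τ * (M ^ τ * (θ - cM M τ * π / 2) / cM M τ - π / 4))

/-- The function `w_τ` on `ℝ`, extended from `[0, π)` by `w_τ(θ + π) = −w_τ(θ)`. -/
def wtau (M τ : ℝ) (θ : ℝ) : ℝ :=
  (-1 : ℝ) ^ ⌊θ / π⌋ * wbase M τ (θ - π * ⌊θ / π⌋)

/-- The function `u_τ(x) = |x|^{μ/c} w_τ(arg x)` (with `u_τ(0) = 0`). -/
def utau (M τ : ℝ) (x : V2) : ℝ :=
  if x = 0 then 0 else ‖x‖ ^ (muM M τ / cM M τ) * wtau M τ (arg2 x)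

def gradf (φ : V2 → ℝ) (x : V2) : Fin 2 → ℝ := fun i => fderiv ℝ φ x (toV (Pi.single i 1))

/-- `g` is the weak gradient of `u` on `Ω`. -/
def IsWeakGradient (Ω : Set V2) (u : V2 → ℝ) (g : V2 → Fin 2 → ℝ) : Prop :=
  ∀ φ : V2 → ℝ, ContDiff ℝ (⊤ : ℕ∞) φ → HasCompactSupport φ → tsupport φ ⊆ Ω →
    ∀ i : Fin 2, (∫ x in Ω, u x * gradf φ x i) = - ∫ x in Ω, g x i * φ x

/-- The unit angular vector `(-sin t, cos t)`. -/
def eitPerp (t : ℝ) : V2 := toV ![-Real.sin t, Real.cos t]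

lemma norm_eit (t : ℝ) : ‖eit t‖ = 1 := by
  simp [eit, toV, EuclideanSpace.norm_eq]

lemma norm_eitPerp (t : ℝ) : ‖eitPerp t‖ = 1 := by
  simp [eitPerp, toV, EuclideanSpace.norm_eq]

lemma hasDerivAt_eit (t : ℝ) : HasDerivAt eit (eitPerp t) t := by
  have h : HasDerivAt (fun t => ![Real.cos t, Real.sin t]) ![-Real.sin t, Real.cos t] t := by
    rw [hasDerivAt_pi]
    intro i
    fin_cases i
    · simpa using Real.hasDerivAt_cos t
    · simpa using Real.hasDerivAt_sin t
  exact (PiLp.continuousLinearEquiv 2 ℝ (fun _ : Fin 2 => ℝ)).symm.hasFDerivAt.comp_hasDerivAt t h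

lemma continuous_eit : Continuous eit :=
  continuous_iff_continuousAt.2 fun t => (hasDerivAt_eit t).continuousAt

lemma continuous_eitPerp : Continuous eitPerp := by
  refine (PiLp.continuous_toLp 2 _).comp (continuous_pi fun i => ?_)
  fin_cases i
  · exact Real.continuous_sin.neg
  · simpa using Real.continuous_cos

lemma arg2_smul_eit {r θ : ℝ} (hr : 0 < r) (hθ : θ ∈ Ico 0 (2 * π)) : arg2 (r • eit θ) = θ := by
  have key (t : ℝ) : Complex.mk ((r • eit t) 0) ((r • eit t) 1)
      = r * (Complex.cos t + Complex.sin t * Complex.I) := by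
    apply Complex.ext <;>
      simp [eit, toV, ← Complex.ofReal_cos, ← Complex.ofReal_sin]
  have hshift : eit θ = eit (θ - 2 * π) := by simp [eit]
  unfold arg2
  rcases le_or_gt θ π with h | h
  · rw [key, Complex.arg_mul_cos_add_sin_mul_I hr ⟨by linarith [hθ.1, Real.pi_pos], h⟩,
      if_pos hθ.1]
  · rw [hshift, key, Complex.arg_mul_cos_add_sin_mul_I hr
      ⟨by linarith, by linarith [hθ.2, Real.pi_pos]⟩, if_neg (by linarith [hθ.2])]
    ring

lemma arg2_mem (x : V2) : arg2 x ∈ Ico 0 (2 * π) := by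
  unfold arg2
  have h1 := Complex.neg_pi_lt_arg (Complex.mk (x 0) (x 1))
  have h2 := Complex.arg_le_pi (Complex.mk (x 0) (x 1))
  split_ifs with h
  · exact ⟨h, by linarith [Real.pi_pos]⟩
  · constructor <;> linarith

lemma measurable_arg2 : Measurable arg2 := by
  have h : Measurable fun x : V2 => Complex.arg (Complex.mk (x 0) (x 1)) := by
    refine Complex.measurable_arg.comp ?_
    have : (fun x : V2 => Complex.mk (x 0) (x 1))
        = fun x : V2 => ((x 0 : ℝ) : ℂ) + ((x 1 : ℝ) : ℂ) * Complex.I := by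
      funext x
      apply Complex.ext <;> simp
    rw [this]
    exact Continuous.measurable (by fun_prop)
  exact Measurable.ite (measurableSet_le measurable_const h) h (h.add_const _)

/-- Integration in polar coordinates over `(0, ∞) × (0, 2π)`. -/
lemma integral_eq_integral_polar (f : V2 → ℝ) :
    ∫ x, f x = ∫ p in Ioi (0 : ℝ) ×ˢ Ioo (0 : ℝ) (2 * π), p.1 * f (p.1 • eit p.2) := by
  have h1 : ∫ x, f x = ∫ p : ℝ × ℝ, f (-(toV ![p.1, p.2])) := by
    rw [← integral_neg_eq_self]
    rw [← (EuclideanSpace.volume_preserving_symm_measurableEquiv_toLp (Fin 2)).symm.integral_comp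
      (MeasurableEquiv.measurableEmbedding _),
      ← (volume_preserving_finTwoArrow ℝ).symm.integral_comp (MeasurableEquiv.measurableEmbedding _)]
    rfl
  rw [h1, ← integral_comp_polarCoord_symm]
  have hT : MeasurePreserving (fun p : ℝ × ℝ => (p.1, p.2 + π)) volume volume :=
    (MeasurePreserving.id volume).prod (measurePreserving_add_right volume π)
  have hE : MeasurableEmbedding (fun p : ℝ × ℝ => (p.1, p.2 + π)) :=
    ((Homeomorph.refl ℝ).prodCongr (Homeomorph.addRight π)).measurableEmbedding
  rw [← hT.setIntegral_preimage_emb hE fun p => p.1 * f (p.1 • eit p.2)]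
  have hs : (fun p : ℝ × ℝ => (p.1, p.2 + π)) ⁻¹' (Ioi (0 : ℝ) ×ˢ Ioo (0 : ℝ) (2 * π))
      = polarCoord.target := by
    ext ⟨r, θ⟩
    simp only [polarCoord_target, mem_preimage, mem_prod, mem_Ioi, mem_Ioo]
    constructor <;> rintro ⟨h, h', h''⟩ <;> refine ⟨h, ?_, ?_⟩ <;> linarith
  rw [hs]
  congr 1
  funext p
  simp only [polarCoord_symm_apply, smul_eq_mul]
  congr 2
  ext i
  fin_cases i <;> simp [toV, eit]

/-- A measurable function on `(0, ∞) × (0, 2π)` dominated by `C r ^ β` with `β > -1`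
and vanishing for large `r` is integrable. -/
lemma integrableOn_polar {h : ℝ × ℝ → ℝ} (hm : Measurable h) {C R β : ℝ} (hβ : -1 < β)
    (hb : ∀ r θ, 0 < r → |h (r, θ)| ≤ C * r ^ β) (h0 : ∀ r θ, R < r → h (r, θ) = 0) :
    IntegrableOn h (Ioi (0 : ℝ) ×ˢ Ioo (0 : ℝ) (2 * π)) := by
  have h1 : IntegrableOn (fun r : ℝ => C * r ^ β) (Ioc 0 (max R 0)) :=
    ((intervalIntegrable_iff_integrableOn_Ioc_of_le (le_max_right _ _)).1
      (intervalIntegral.intervalIntegrable_rpow' hβ)).const_mul C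
  have h2 : Integrable ((Ioc 0 (max R 0)).indicator fun r : ℝ => C * r ^ β)
      (volume.restrict (Ioi 0)) :=
    ((integrable_indicator_iff measurableSet_Ioc).2 h1).integrableOn
  have h3 : Integrable (fun _ : ℝ => (1 : ℝ)) (volume.restrict (Ioo (0 : ℝ) (2 * π))) :=
    integrable_const _
  rw [IntegrableOn, Measure.volume_eq_prod, ← Measure.prod_restrict]
  refine (h2.mul_prod h3).mono' hm.aestronglyMeasurable ?_
  rw [Measure.prod_restrict, ae_restrict_iff' (measurableSet_Ioi.prod measurableSet_Ioo)]
  filter_upwards with p hp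
  obtain ⟨r, θ⟩ := p
  have hr : 0 < r := hp.1
  rw [Real.norm_eq_abs, mul_one]
  by_cases hR : R < r
  · rw [h0 r θ hR, abs_zero]
    refine Set.indicator_nonneg (fun s hs => ?_) _
    exact (abs_nonneg _).trans (hb s θ hs.1)
  · rw [Set.indicator_of_mem]
    · exact hb r θ hr
    · exact ⟨hr, le_max_of_le_left (not_lt.1 hR)⟩

/-- Divergence theorem for the vector field `r ^ β (a(θ) e_r + b(θ) e_θ)` tested against `φ`. -/
lemma integral_polarField_mul_fderiv {a b b' : ℝ → ℝ} {β C : ℝ} (hβ : -1 < β)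
    (ham : Measurable a) (hbc : Continuous b) (hbm : Measurable b')
    (haC : ∀ θ, |a θ| ≤ C) (hbC : ∀ θ, |b θ| ≤ C) (hb'C : ∀ θ, |b' θ| ≤ C)
    (hper : b (2 * π) = b 0) {S : Set ℝ} (hS : S.Countable)
    (hder : ∀ θ, θ ∉ S → HasDerivAt b (b' θ) θ)
    {φ : V2 → ℝ} (hφ : ContDiff ℝ (⊤ : ℕ∞) φ) (hc : HasCompactSupport φ) :
    ∫ x, ‖x‖ ^ β * (a (arg2 x) * fderiv ℝ φ x (eit (arg2 x))
        + b (arg2 x) * fderiv ℝ φ x (eitPerp (arg2 x)))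
      = - ∫ x, ‖x‖ ^ (β - 1) * ((β + 1) * a (arg2 x) + b' (arg2 x)) * φ x := by
  have hdc : Continuous (fderiv ℝ φ) := hφ.continuous_fderiv (by simp)
  have hdiff (x : V2) : HasFDerivAt φ (fderiv ℝ φ x) x :=
    (hφ.differentiable (by simp) x).hasFDerivAt
  obtain ⟨D, hD⟩ := hφ.continuous.bounded_above_of_compact_support hc
  obtain ⟨D', hD'⟩ := hdc.bounded_above_of_compact_support (hc.fderiv ℝ)
  have hD0 : 0 ≤ D := (norm_nonneg _).trans (hD 0)
  have hD'0 : 0 ≤ D' := (norm_nonneg _).trans (hD' 0)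
  have hC0 : 0 ≤ C := (abs_nonneg _).trans (haC 0)
  obtain ⟨R, hR⟩ := hc.isCompact.isBounded.subset_closedBall (0 : V2)
  have hnorm {r : ℝ} (hr : 0 < r) (θ : ℝ) : ‖r • eit θ‖ = r := by
    rw [norm_smul, norm_eit, mul_one, Real.norm_of_nonneg hr.le]
  have hfar {r : ℝ} (hr : max R 0 < r) (θ : ℝ) : r • eit θ ∉ tsupport φ := fun h => by
    have := hR h
    rw [mem_closedBall_zero_iff, hnorm ((le_max_right _ _).trans_lt hr)] at this
    exact absurd ((le_max_left _ _).trans_lt hr) (not_lt.2 this)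
  have hφ0 {r : ℝ} (hr : max R 0 < r) (θ : ℝ) : φ (r • eit θ) = 0 :=
    image_eq_zero_of_notMem_tsupport (hfar hr θ)
  have hφ'0 {r : ℝ} (hr : max R 0 < r) (θ : ℝ) : fderiv ℝ φ (r • eit θ) = 0 :=
    image_eq_zero_of_notMem_tsupport fun h => hfar hr θ (tsupport_fderiv_subset ℝ h)
  have hcurve : Continuous fun p : ℝ × ℝ => p.1 • eit p.2 :=
    continuous_fst.smul (continuous_eit.comp continuous_snd)
  have hΦm : Measurable fun p : ℝ × ℝ => φ (p.1 • eit p.2) :=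
    (hφ.continuous.comp hcurve).measurable
  have hΦrm : Measurable fun p : ℝ × ℝ => fderiv ℝ φ (p.1 • eit p.2) (eit p.2) :=
    ((hdc.comp hcurve).clm_apply (continuous_eit.comp continuous_snd)).measurable
  have hΦtm : Measurable fun p : ℝ × ℝ => fderiv ℝ φ (p.1 • eit p.2) (eitPerp p.2) :=
    ((hdc.comp hcurve).clm_apply (continuous_eitPerp.comp continuous_snd)).measurable
  have hΦr (x : V2) (θ : ℝ) : |fderiv ℝ φ x (eit θ)| ≤ D' := by
    have := (fderiv ℝ φ x).le_of_opNorm_le (hD' x) (eit θ)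
    rwa [norm_eit, mul_one] at this
  have hΦt (x : V2) (θ : ℝ) : |fderiv ℝ φ x (eitPerp θ)| ≤ D' := by
    have := (fderiv ℝ φ x).le_of_opNorm_le (hD' x) (eitPerp θ)
    rwa [norm_eitPerp, mul_one] at this
  have hpm (s : ℝ) : Measurable fun p : ℝ × ℝ => p.1 ^ s := measurable_fst.pow_const s
  set Ω : Set (ℝ × ℝ) := Ioi (0 : ℝ) ×ˢ Ioo (0 : ℝ) (2 * π) with hΩ
  have hΩm : MeasurableSet Ω := measurableSet_Ioi.prod measurableSet_Ioo
  set G1 : ℝ × ℝ → ℝ := fun p =>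
    p.1 ^ (β + 1) * a p.2 * fderiv ℝ φ (p.1 • eit p.2) (eit p.2) with hG1
  set G2 : ℝ × ℝ → ℝ := fun p =>
    p.1 ^ (β + 1) * b p.2 * fderiv ℝ φ (p.1 • eit p.2) (eitPerp p.2) with hG2
  set G3 : ℝ × ℝ → ℝ := fun p => p.1 ^ β * a p.2 * φ (p.1 • eit p.2) with hG3
  set G4 : ℝ × ℝ → ℝ := fun p => p.1 ^ β * b' p.2 * φ (p.1 • eit p.2) with hG4
  have bound {s c f E : ℝ} {r : ℝ} (hr : 0 < r) (h1 : |c| ≤ C) (h2 : |f| ≤ E) (hE : 0 ≤ E) :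
      |r ^ s * c * f| ≤ C * E * r ^ s := by
    rw [abs_mul, abs_mul, abs_of_nonneg (Real.rpow_nonneg hr.le s)]
    calc r ^ s * |c| * |f| = (|c| * |f|) * r ^ s := by ring
      _ ≤ C * E * r ^ s := by gcongr
  have hI1 : IntegrableOn G1 Ω := by
    refine integrableOn_polar (((hpm _).mul (ham.comp measurable_snd)).mul hΦrm)
      (R := max R 0) (by linarith : -1 < β + 1)
      (fun r θ hr => bound hr (haC θ) (hΦr _ θ) hD'0) fun r θ hr => ?_
    simp [hG1, hφ'0 hr]
  have hI2 : IntegrableOn G2 Ω := by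
    refine integrableOn_polar (((hpm _).mul (hbc.measurable.comp measurable_snd)).mul hΦtm)
      (R := max R 0) (by linarith : -1 < β + 1)
      (fun r θ hr => bound hr (hbC θ) (hΦt _ θ) hD'0) fun r θ hr => ?_
    simp [hG2, hφ'0 hr]
  have hI3 : IntegrableOn G3 Ω := by
    refine integrableOn_polar (((hpm _).mul (ham.comp measurable_snd)).mul hΦm)
      (R := max R 0) hβ (fun r θ hr => bound hr (haC θ) (hD _) hD0) fun r θ hr => ?_
    simp [hG3, hφ0 hr]
  have hI4 : IntegrableOn G4 Ω := by
    refine integrableOn_polar (((hpm _).mul (hbm.comp measurable_snd)).mul hΦm)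
      (R := max R 0) hβ (fun r θ hr => bound hr (hb'C θ) (hD _) hD0) fun r θ hr => ?_
    simp [hG4, hφ0 hr]
  -- radial integration by parts
  have hrad : ∫ p in Ω, (G1 p + (β + 1) * G3 p) = 0 := by
    have hI : IntegrableOn (fun p => G1 p + (β + 1) * G3 p) Ω := hI1.add (hI3.const_mul _)
    rw [IntegrableOn, hΩ, Measure.volume_eq_prod, ← Measure.prod_restrict] at hI
    rw [hΩ, Measure.volume_eq_prod, ← Measure.prod_restrict, integral_prod_symm _ hI]
    refine integral_eq_zero_of_ae ?_
    filter_upwards [hI.prod_left_ae] with θ hθ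
    have hd (r : ℝ) (hr : r ∈ Ioi (0 : ℝ)) :
        HasDerivAt (fun r : ℝ => a θ * (r ^ (β + 1) * φ (r • eit θ)))
          (G1 (r, θ) + (β + 1) * G3 (r, θ)) r := by
      have h1 : HasDerivAt (fun r : ℝ => r ^ (β + 1)) ((β + 1) * r ^ β) r := by
        simpa using Real.hasDerivAt_rpow_const (p := β + 1) (Or.inl (ne_of_gt hr))
      have h2 : HasDerivAt (fun r : ℝ => φ (r • eit θ)) (fderiv ℝ φ (r • eit θ) (eit θ)) r := by
        have h3 : HasDerivAt (fun r : ℝ => r • eit θ) (eit θ) r := by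
          simpa using (hasDerivAt_id r).smul_const (eit θ)
        exact (hdiff (r • eit θ)).comp_hasDerivAt r h3
      refine ((h1.mul h2).const_mul (a θ)).congr_deriv ?_
      simp only [hG1, hG3]
      ring
    have hcont : ContinuousWithinAt (fun r : ℝ => a θ * (r ^ (β + 1) * φ (r • eit θ)))
        (Ici 0) 0 := by
      refine Continuous.continuousWithinAt ?_
      refine continuous_const.mul ((Real.continuous_rpow_const (by linarith)).mul ?_)
      exact hφ.continuous.comp (continuous_id.smul continuous_const)
    have hlim : Filter.Tendsto (fun r : ℝ => a θ * (r ^ (β + 1) * φ (r • eit θ)))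
        Filter.atTop (nhds 0) := by
      refine tendsto_const_nhds.congr' ?_
      filter_upwards [Filter.eventually_gt_atTop (max R 0)] with r hr
      simp [hφ0 hr]
    have := integral_Ioi_of_hasDerivAt_of_tendsto hcont hd hθ hlim
    rw [this]
    simp [Real.zero_rpow (by linarith : β + 1 ≠ 0)]
  -- angular integration by parts
  have hang : ∫ p in Ω, (G2 p + G4 p) = 0 := by
    have hI : IntegrableOn (fun p => G2 p + G4 p) Ω := hI2.add hI4
    have hI' := hI
    rw [IntegrableOn, hΩ, Measure.volume_eq_prod, ← Measure.prod_restrict] at hI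
    rw [hΩ, Measure.volume_eq_prod, ← Measure.prod_restrict, integral_prod _ hI]
    refine integral_eq_zero_of_ae ?_
    filter_upwards [hI.prod_right_ae, ae_restrict_mem measurableSet_Ioi] with r hint hr
    have hr0 : (0 : ℝ) < r := hr
    have hd (θ : ℝ) (hθ : θ ∈ Ioo 0 (2 * π) \ S) :
        HasDerivAt (fun θ : ℝ => r ^ β * (b θ * φ (r • eit θ))) (G2 (r, θ) + G4 (r, θ)) θ := by
      have h2 : HasDerivAt (fun θ : ℝ => φ (r • eit θ))
          (fderiv ℝ φ (r • eit θ) (r • eitPerp θ)) θ :=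
        (hdiff (r • eit θ)).comp_hasDerivAt θ ((hasDerivAt_eit θ).const_smul r)
      refine (((hder θ hθ.2).mul h2).const_mul (r ^ β)).congr_deriv ?_
      simp only [hG2, hG4, map_smul, smul_eq_mul, Real.rpow_add_one hr0.ne']
      ring
    have hcont : ContinuousOn (fun θ : ℝ => r ^ β * (b θ * φ (r • eit θ))) (Icc 0 (2 * π)) := by
      refine Continuous.continuousOn (continuous_const.mul (hbc.mul ?_))
      exact hφ.continuous.comp (continuous_eit.const_smul r)
    have hint' : IntervalIntegrable (fun θ => G2 (r, θ) + G4 (r, θ)) volume 0 (2 * π) := by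
      rw [intervalIntegrable_iff_integrableOn_Ioo_of_le Real.two_pi_pos.le]
      exact hint
    have := integral_eq_of_hasDerivAt_off_countable_of_le _ _ Real.two_pi_pos.le
      hS hcont hd hint'
    rw [intervalIntegral.integral_of_le Real.two_pi_pos.le, integral_Ioc_eq_integral_Ioo] at this
    rw [this, hper]
    simp [eit]
  rw [integral_add hI1 (hI3.const_mul _), MeasureTheory.integral_const_mul] at hrad
  rw [integral_add hI2 hI4] at hang
  have hL : ∀ p ∈ Ω, p.1 * (‖p.1 • eit p.2‖ ^ β *
      (a (arg2 (p.1 • eit p.2)) * fderiv ℝ φ (p.1 • eit p.2) (eit (arg2 (p.1 • eit p.2)))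
        + b (arg2 (p.1 • eit p.2)) * fderiv ℝ φ (p.1 • eit p.2) (eitPerp (arg2 (p.1 • eit p.2)))))
      = G1 p + G2 p := by
    rintro ⟨r, θ⟩ ⟨hr, hθ⟩
    have hr0 : (0 : ℝ) < r := hr
    simp only [hG1, hG2, arg2_smul_eit hr0 ⟨hθ.1.le, hθ.2⟩, hnorm hr0, Real.rpow_add_one hr0.ne']
    ring
  have hRt : ∀ p ∈ Ω, p.1 * (‖p.1 • eit p.2‖ ^ (β - 1) *
      ((β + 1) * a (arg2 (p.1 • eit p.2)) + b' (arg2 (p.1 • eit p.2))) * φ (p.1 • eit p.2))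
      = (β + 1) * G3 p + G4 p := by
    rintro ⟨r, θ⟩ ⟨hr, hθ⟩
    have hr0 : (0 : ℝ) < r := hr
    simp only [hG3, hG4, arg2_smul_eit hr0 ⟨hθ.1.le, hθ.2⟩, hnorm hr0,
      Real.rpow_sub_one hr0.ne']
    field_simp
  rw [integral_eq_integral_polar, integral_eq_integral_polar (fun x => ‖x‖ ^ (β - 1) * _ * φ x),
    setIntegral_congr_fun hΩm hL, setIntegral_congr_fun hΩm hRt,
    integral_add hI1 hI2, integral_add (hI3.const_mul _) hI4, MeasureTheory.integral_const_mul]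
  linarith

/-- The function equal to `p` on `(-∞, s)` and `q` on `[s, π)`, continued to `[π, ∞)` by
`f (θ) = -f (θ - π)`. -/
def antiGlue (s : ℝ) (p q : ℝ → ℝ) (θ : ℝ) : ℝ :=
  if θ < π then (if θ < s then p θ else q θ)
  else -(if θ - π < s then p (θ - π) else q (θ - π))

lemma measurable_antiGlue {s : ℝ} {p q : ℝ → ℝ} (hp : Measurable p) (hq : Measurable q) :
    Measurable (antiGlue s p q) := by
  have h : Measurable fun θ => if θ < s then p θ else q θ :=
    Measurable.ite measurableSet_Iio hp hq
  exact Measurable.ite measurableSet_Iio h (h.comp (measurable_id.sub_const π)).neg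

lemma abs_antiGlue_le {s C : ℝ} {p q : ℝ → ℝ} (hp : ∀ θ, |p θ| ≤ C) (hq : ∀ θ, |q θ| ≤ C)
    (θ : ℝ) : |antiGlue s p q θ| ≤ C := by
  unfold antiGlue
  split_ifs
  · exact hp _
  · exact hq _
  · exact (abs_neg _).trans_le (hp _)
  · exact (abs_neg _).trans_le (hq _)

lemma continuous_antiGlue {s : ℝ} {p q : ℝ → ℝ} (hp : Continuous p) (hq : Continuous q)
    (hs0 : 0 < s) (hsπ : s < π) (hs : p s = q s) (hπ : q π = -p 0) :
    Continuous (antiGlue s p q) := by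
  have h : Continuous fun θ => if θ < s then p θ else q θ := by
    have h' : Continuous fun θ => if s ≤ θ then q θ else p θ :=
      Continuous.if_le hq hp continuous_const continuous_id fun θ hθ => by rw [← hθ, hs]
    convert h' using 2 with θ
    by_cases hθ : θ < s
    · rw [if_pos hθ, if_neg (not_le.2 hθ)]
    · rw [if_neg hθ, if_pos (not_lt.1 hθ)]
  have h2 : Continuous fun θ => if π ≤ θ then -(if θ - π < s then p (θ - π) else q (θ - π))
      else (if θ < s then p θ else q θ) := by
    refine Continuous.if_le (h.comp (continuous_id.sub continuous_const)).neg h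
      continuous_const continuous_id fun θ hθ => ?_
    subst hθ
    rw [sub_self, if_pos hs0, if_neg (not_lt.2 hsπ.le), hπ]
  unfold antiGlue
  convert h2 using 2 with θ
  by_cases hθ : θ < π
  · rw [if_pos hθ, if_neg (not_le.2 hθ)]
  · rw [if_neg hθ, if_pos (not_lt.1 hθ)]

lemma hasDerivAt_antiGlue {s θ : ℝ} {p q p' q' : ℝ → ℝ} (hp : ∀ θ, HasDerivAt p (p' θ) θ)
    (hq : ∀ θ, HasDerivAt q (q' θ) θ) (hθ : θ ∉ ({s, π, π + s} : Set ℝ)) :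
    HasDerivAt (antiGlue s p q) (antiGlue s p' q' θ) θ := by
  have key {t : ℝ} (ht : t ≠ s) : HasDerivAt (fun θ => if θ < s then p θ else q θ)
      (if t < s then p' t else q' t) t := by
    rcases lt_or_gt_of_ne ht with h | h
    · rw [if_pos h]
      refine (hp t).congr_of_eventuallyEq ?_
      filter_upwards [Iio_mem_nhds h] with y hy
      exact if_pos hy
    · rw [if_neg (not_lt.2 h.le)]
      refine (hq t).congr_of_eventuallyEq ?_
      filter_upwards [Ioi_mem_nhds h] with y hy
      exact if_neg (not_lt.2 (le_of_lt hy))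
  simp only [mem_insert_iff, mem_singleton_iff, not_or] at hθ
  obtain ⟨h1, h2, h3⟩ := hθ
  rcases lt_or_gt_of_ne h2 with h | h
  · have : antiGlue s p' q' θ = if θ < s then p' θ else q' θ := if_pos h
    rw [this]
    refine (key h1).congr_of_eventuallyEq ?_
    filter_upwards [Iio_mem_nhds h] with y hy
    exact if_pos hy
  · have : antiGlue s p' q' θ = -(if θ - π < s then p' (θ - π) else q' (θ - π)) :=
      if_neg (not_lt.2 h.le)
    rw [this]
    have hne : θ - π ≠ s := fun h' => h3 (by linarith)
    refine ((key hne).comp_sub_const θ π).neg.congr_of_eventuallyEq ?_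
    filter_upwards [Ioi_mem_nhds h] with y hy
    exact if_neg (not_lt.2 (le_of_lt hy))

lemma antiGlue_two_pi {s : ℝ} {p q : ℝ → ℝ} (hs0 : 0 < s) (hsπ : s < π) (hπ : q π = -p 0) :
    antiGlue s p q (2 * π) = antiGlue s p q 0 := by
  have hpi := Real.pi_pos
  unfold antiGlue
  rw [if_neg (by linarith), if_neg (by linarith), if_pos hpi, if_pos hs0,
    show 2 * π - π = π by ring, hπ, neg_neg]

lemma toV_single (θ : ℝ) (i : Fin 2) :
    toV (Pi.single i 1) = eit θ i • eit θ + eitPerp θ i • eitPerp θ := by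
  have h := Real.sin_sq_add_cos_sq θ
  ext j
  fin_cases i <;> fin_cases j <;> simp [toV, eit, eitPerp] <;> linarith

lemma eit_eq (θ : ℝ) : eit θ = Real.cos θ • toV (Pi.single 0 1) + Real.sin θ • toV (Pi.single 1 1) := by
  ext j
  fin_cases j <;> simp [toV, eit]

lemma eitPerp_eq (θ : ℝ) :
    eitPerp θ = -Real.sin θ • toV (Pi.single 0 1) + Real.cos θ • toV (Pi.single 1 1) := by
  ext j
  fin_cases j <;> simp [toV, eitPerp]

lemma gradf_eq (φ : V2 → ℝ) (x : V2) (θ : ℝ) (i : Fin 2) :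
    gradf φ x i = eit θ i * fderiv ℝ φ x (eit θ) + eitPerp θ i * fderiv ℝ φ x (eitPerp θ) := by
  unfold gradf
  rw [toV_single θ i, map_add, map_smul, map_smul, smul_eq_mul, smul_eq_mul]

/-- The rotated matrix `J(θ) diag(k, l) J(θ)ᵀ` acts diagonally in the polar frame. -/
lemma dot2_rotated_diagonal (φ : V2 → ℝ) (x : V2) (θ k l c₁ c₂ : ℝ) :
    dot2 ((Jmat θ * Matrix.diagonal ![k, l] * (Jmat θ)ᵀ).mulVec
      (fun i => c₁ * eit θ i + c₂ * eitPerp θ i)) (gradf φ x)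
      = k * c₁ * fderiv ℝ φ x (eit θ) + l * c₂ * fderiv ℝ φ x (eitPerp θ) := by
  have h := Real.sin_sq_add_cos_sq θ
  have h0 : gradf φ x 0 = fderiv ℝ φ x (toV (Pi.single 0 1)) := rfl
  have h1 : gradf φ x 1 = fderiv ℝ φ x (toV (Pi.single 1 1)) := rfl
  rw [eit_eq θ, eitPerp_eq θ, map_add, map_add, map_smul, map_smul, map_smul, map_smul, ← h0, ← h1]
  simp only [dot2, Matrix.mulVec, dotProduct, Fin.sum_univ_two, Matrix.mul_apply, Jmat,
    Matrix.transpose_apply, Matrix.diagonal_apply, toV, smul_eq_mul]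
  simp
  generalize Real.cos θ = c at *
  generalize Real.sin θ = s at *
  have hc : c ^ 2 = 1 - s ^ 2 := by linarith
  have hc3 : c ^ 3 = c * (1 - s ^ 2) := by rw [← hc]; ring
  ring_nf
  rw [hc3, hc]
  ring

lemma abs_eit_le (θ : ℝ) (i : Fin 2) : |eit θ i| ≤ 1 := by
  have := PiLp.norm_apply_le (eit θ) i
  rwa [norm_eit] at this

lemma abs_eitPerp_le (θ : ℝ) (i : Fin 2) : |eitPerp θ i| ≤ 1 := by
  have := PiLp.norm_apply_le (eitPerp θ) i
  rwa [norm_eitPerp] at this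

lemma hasDerivAt_eitPerp_apply (θ : ℝ) (i : Fin 2) :
    HasDerivAt (fun θ => eitPerp θ i) (-eit θ i) θ := by
  fin_cases i
  · exact (Real.hasDerivAt_sin θ).neg
  · simpa [eitPerp, eit, toV] using Real.hasDerivAt_cos θ

lemma continuous_eit_apply (i : Fin 2) : Continuous fun θ => eit θ i :=
  (continuous_apply i).comp ((PiLp.continuous_ofLp 2 _).comp continuous_eit)

lemma continuous_eitPerp_apply (i : Fin 2) : Continuous fun θ => eitPerp θ i :=
  (continuous_apply i).comp ((PiLp.continuous_ofLp 2 _).comp continuous_eitPerp)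

lemma integrableOn_ball_of_abs_le_norm_rpow {f : V2 → ℝ} (hf : Measurable f) {C γ : ℝ}
    (hγ : -2 < γ) (hb : ∀ x, |f x| ≤ C * ‖x‖ ^ γ) : IntegrableOn f (Metric.ball (0 : V2) 1) := by
  have h : IntegrableOn (fun x : V2 => C * ‖x‖ ^ γ) (Metric.ball (0 : V2) 1) := by
    rw [integrableOn_fun_norm_addHaar volume (f := fun y : ℝ => C * y ^ γ)]
    have h1 : IntegrableOn (fun r : ℝ => C * r ^ (γ + 1)) (Ioo 0 1) :=
      ((intervalIntegrable_iff_integrableOn_Ioo_of_le zero_le_one).1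
        (intervalIntegral.intervalIntegrable_rpow' (by linarith))).const_mul C
    refine h1.congr_fun (fun r hr => ?_) measurableSet_Ioo
    simp only [finrank_euclideanSpace, Fintype.card_fin, smul_eq_mul, Real.rpow_add_one hr.1.ne']
    ring
  exact h.mono' hf.aestronglyMeasurable (Filter.Eventually.of_forall fun x => hb x)

lemma cM_pos {M τ : ℝ} (hM : 1 < M) : 0 < cM M τ := by
  have := Real.rpow_pos_of_pos (zero_lt_one.trans hM) (-τ)
  unfold cM
  positivity

lemma cM_lt_two {M τ : ℝ} (hM : 1 < M) : cM M τ < 2 := by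
  have := Real.rpow_pos_of_pos (zero_lt_one.trans hM) (-τ)
  unfold cM
  rw [div_lt_iff₀ (by positivity)]
  linarith

lemma rpow_mul_sub_div_cM {M τ : ℝ} (hM : 1 < M) :
    M ^ τ * (π - cM M τ * π / 2) / cM M τ = π / 2 := by
  have h0 := zero_lt_one.trans hM
  have h1 := Real.rpow_pos_of_pos h0 τ
  unfold cM
  rw [Real.rpow_neg h0.le]
  field_simp
  ring

lemma muM_pos {M τ : ℝ} (hM : 1 < M) : 0 < muM M τ := by
  have := Real.arctan_pos.2 (Real.rpow_pos_of_pos (zero_lt_one.trans hM) (-(1 - τ) / 2))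
  have := Real.pi_pos
  unfold muM
  positivity

lemma sin_muM_mul (M τ : ℝ) :
    Real.sin (muM M τ * (π / 4)) = M ^ (-(1 - τ) / 2) * Real.cos (muM M τ * (π / 4)) := by
  have h : muM M τ * (π / 4) = arctan (M ^ (-(1 - τ) / 2)) := by
    unfold muM
    field_simp
  rw [h, ← Real.tan_mul_cos (Real.cos_arctan_pos _).ne', Real.tan_arctan]

lemma wtau_eq_antiGlue {M τ θ : ℝ} (hθ : θ ∈ Ico 0 (2 * π)) :
    wtau M τ θ = antiGlue (cM M τ * π / 2)
      (fun θ => Real.sin (muM M τ * (θ / cM M τ - π / 4)))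
      (fun θ => M ^ (-(1 - τ) / 2) *
        Real.cos (muM M τ * (M ^ τ * (θ - cM M τ * π / 2) / cM M τ - π / 4))) θ := by
  have hpi := Real.pi_pos
  unfold wtau antiGlue
  by_cases h : θ < π
  · have hf : ⌊θ / π⌋ = 0 := by
      rw [Int.floor_eq_zero_iff]
      exact ⟨div_nonneg hθ.1 hpi.le, (div_lt_one hpi).2 h⟩
    rw [hf, if_pos h]
    simp [wbase]
  · have hf : ⌊θ / π⌋ = 1 := by
      rw [Int.floor_eq_iff]
      refine ⟨?_, ?_⟩
      · rw [le_div_iff₀ hpi]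
        push_cast
        linarith
      · rw [div_lt_iff₀ hpi]
        push_cast
        linarith [hθ.2]
    rw [hf, if_neg h, zpow_one, Int.cast_one, mul_one, neg_one_mul]
    rfl

lemma Ktau_eq {M τ : ℝ} (hM : 1 < M) (x : V2) :
    Ktau M τ x = Matrix.diagonal
      ![if arg2 x < π then (if arg2 x < cM M τ * π / 2 then 1 else M)
          else (if arg2 x - π < cM M τ * π / 2 then 1 else M),
        if arg2 x < π then (if arg2 x < cM M τ * π / 2 then 1 else M ^ (1 - 2 * τ))
          else (if arg2 x - π < cM M τ * π / 2 then 1 else M ^ (1 - 2 * τ))] := by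
  have hpi := Real.pi_pos
  have hs : cM M τ * π / 2 < π := by nlinarith [cM_lt_two (τ := τ) hM]
  have h1 : (1 : Matrix (Fin 2) (Fin 2) ℝ) = Matrix.diagonal ![1, 1] := by
    ext i j
    fin_cases i <;> fin_cases j <;> simp
  have h0 := (arg2_mem x).1
  unfold Ktau
  simp only [mem_union, mem_Ico, h1]
  split_ifs <;> first | rfl | (exfalso; grind)

/-- The gradient of `r ^ α W(θ)`, where `W'` is the derivative of `W`. -/
def polarGrad (α : ℝ) (W W' : ℝ → ℝ) (x : V2) (i : Fin 2) : ℝ :=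
  ‖x‖ ^ (α - 1) * (α * W (arg2 x) * eit (arg2 x) i + W' (arg2 x) * eitPerp (arg2 x) i)

lemma integral_polar_mul_gradf {W W' : ℝ → ℝ} {α C : ℝ} (hα : 0 < α)
    (hWc : Continuous W) (hWm : Measurable W') (hWC : ∀ θ, |W θ| ≤ C) (hW'C : ∀ θ, |W' θ| ≤ C)
    (hper : W (2 * π) = W 0) {S : Set ℝ} (hS : S.Countable)
    (hder : ∀ θ, θ ∉ S → HasDerivAt W (W' θ) θ)
    {φ : V2 → ℝ} (hφ : ContDiff ℝ (⊤ : ℕ∞) φ) (hc : HasCompactSupport φ) (i : Fin 2) :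
    ∫ x, (‖x‖ ^ α * W (arg2 x)) * gradf φ x i = - ∫ x, polarGrad α W W' x i * φ x := by
  have hC0 : 0 ≤ C := (abs_nonneg _).trans (hWC 0)
  have hmul {u v : ℝ} (hu : |u| ≤ C) (hv : |v| ≤ 1) : |u * v| ≤ C := by
    rw [abs_mul]
    nlinarith [abs_nonneg u, abs_nonneg v]
  have key := integral_polarField_mul_fderiv (a := fun θ => W θ * eit θ i)
    (b := fun θ => W θ * eitPerp θ i) (b' := fun θ => W' θ * eitPerp θ i + W θ * -eit θ i)
    (β := α) (C := C + C) (by linarith)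
    (hWc.mul (continuous_eit_apply i)).measurable (hWc.mul (continuous_eitPerp_apply i))
    ((hWm.mul (continuous_eitPerp_apply i).measurable).add
      (hWc.mul (continuous_eit_apply i).neg).measurable)
    (fun θ => (hmul (hWC θ) (abs_eit_le θ i)).trans (by linarith))
    (fun θ => (hmul (hWC θ) (abs_eitPerp_le θ i)).trans (by linarith))
    (fun θ => (abs_add_le _ _).trans (add_le_add (hmul (hW'C θ) (abs_eitPerp_le θ i))
      (hmul (hWC θ) ((abs_neg _).trans_le (abs_eit_le θ i)))))
    (by simp [hper, eitPerp]) hS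
    (fun θ hθ => (hder θ hθ).mul (hasDerivAt_eitPerp_apply θ i)) hφ hc
  convert key using 1
  · congr 1
    funext x
    rw [gradf_eq φ x (arg2 x) i]
    ring
  · congr 2
    funext x
    simp only [polarGrad]
    ring

lemma integrableOn_dot2_polarGrad {W W' : ℝ → ℝ} {α C : ℝ} (hα : 0 < α)
    (hWm : Measurable W) (hW'm : Measurable W') (hWC : ∀ θ, |W θ| ≤ C) (hW'C : ∀ θ, |W' θ| ≤ C) :
    IntegrableOn (fun x => dot2 (polarGrad α W W' x) (polarGrad α W W' x))
      (Metric.ball (0 : V2) 1) := by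
  have heq (x : V2) : dot2 (polarGrad α W W' x) (polarGrad α W W' x)
      = ‖x‖ ^ (2 * α - 2) * (α ^ 2 * W (arg2 x) ^ 2 + W' (arg2 x) ^ 2) := by
    have h := Real.sin_sq_add_cos_sq (arg2 x)
    have hr : ‖x‖ ^ (2 * α - 2) = (‖x‖ ^ (α - 1)) ^ 2 := by
      rw [← Real.rpow_mul_natCast (norm_nonneg x)]
      congr 1
      push_cast
      ring
    rw [hr]
    simp only [dot2, polarGrad, eit, eitPerp, toV, WithLp.equiv_symm_apply,
      Matrix.cons_val_zero, Matrix.cons_val_one]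
    linear_combination ((‖x‖ ^ (α - 1)) ^ 2 * (α ^ 2 * W (arg2 x) ^ 2 + W' (arg2 x) ^ 2)) * h
  simp only [heq]
  refine integrableOn_ball_of_abs_le_norm_rpow (C := α ^ 2 * C ^ 2 + C ^ 2) (γ := 2 * α - 2)
    ?_ (by linarith) fun x => ?_
  · exact (measurable_norm.pow_const _).mul
      ((((hWm.comp measurable_arg2).pow_const 2).const_mul _).add
        ((hW'm.comp measurable_arg2).pow_const 2))
  · have h1 := sq_le_sq' (abs_le.1 (hWC (arg2 x))).1 (abs_le.1 (hWC (arg2 x))).2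
    have h2 := sq_le_sq' (abs_le.1 (hW'C (arg2 x))).1 (abs_le.1 (hW'C (arg2 x))).2
    rw [abs_of_nonneg (by positivity), mul_comm]
    gcongr

lemma gradf_eq_zero_of_notMem_tsupport {φ : V2 → ℝ} {x : V2} (hx : x ∉ tsupport φ) :
    gradf φ x = 0 := by
  funext i
  have : fderiv ℝ φ x = 0 :=
    image_eq_zero_of_notMem_tsupport fun h => hx (tsupport_fderiv_subset ℝ h)
  simp [gradf, this]

set_option maxHeartbeats 1000000 in
/-- The function `u_τ(x) = |x|^{μ/c} w_τ(arg x)` belongs to `H¹(B₁(0))`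
and is a weak solution of `div(A_τ ∇u) = 0` in the unit disk. -/
theorem stmt16 (M τ : ℝ) (hM : 1 < M) (hτ0 : 0 ≤ τ) (hτ1 : τ ≤ 1) :
    ∃ g : V2 → Fin 2 → ℝ,
      IntegrableOn (fun x => (utau M τ x) ^ 2) (Metric.ball (0 : V2) 1) ∧
      IntegrableOn (fun x => dot2 (g x) (g x)) (Metric.ball (0 : V2) 1) ∧
      IsWeakGradient (Metric.ball (0 : V2) 1) (utau M τ) g ∧
      ∀ φ : V2 → ℝ, ContDiff ℝ (⊤ : ℕ∞) φ → HasCompactSupport φ →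
        tsupport φ ⊆ Metric.ball (0 : V2) 1 →
        (∫ x in Metric.ball (0 : V2) 1,
          dot2 ((Atau M τ x).mulVec (g x)) (gradf φ x)) = 0 := by
 

  have hM0 : 0 < M := zero_lt_one.trans hM
  have hpi := Real.pi_pos
  have hc0 := cM_pos (τ := τ) hM
  have hc2 := cM_lt_two (τ := τ) hM
  have hμ := muM_pos (τ := τ) hM
  have hsc := sin_muM_mul M τ
  have hend := rpow_mul_sub_div_cM (τ := τ) hM
  have hmN : M ^ (1 - 2 * τ) * (M ^ τ) ^ 2 = M := by
    rw [← Real.rpow_mul_natCast hM0.le, ← Real.rpow_add hM0]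
    conv_rhs => rw [← Real.rpow_one M]
    congr 1
    push_cast
    ring
  have hmκ : M ^ (1 - 2 * τ) * (M ^ (-(1 - τ) / 2)) ^ 2 * M ^ τ = 1 := by
    rw [← Real.rpow_mul_natCast hM0.le, ← Real.rpow_add hM0, ← Real.rpow_add hM0]
    conv_rhs => rw [← Real.rpow_zero M]
    congr 1
    push_cast
    ring
  have hκ0 : 0 < M ^ (-(1 - τ) / 2) := Real.rpow_pos_of_pos hM0 _
  have hN0 : 0 < M ^ τ := Real.rpow_pos_of_pos hM0 _
  have hm0 : 0 < M ^ (1 - 2 * τ) := Real.rpow_pos_of_pos hM0 _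
  have hu (x : V2) : utau M τ x = ‖x‖ ^ (muM M τ / cM M τ) * antiGlue (cM M τ * π / 2)
      (fun θ => Real.sin (muM M τ * (θ / cM M τ - π / 4)))
      (fun θ => M ^ (-(1 - τ) / 2) *
        Real.cos (muM M τ * (M ^ τ * (θ - cM M τ * π / 2) / cM M τ - π / 4))) (arg2 x) := by
    unfold utau
    split_ifs with hx
    · rw [hx, norm_zero, Real.zero_rpow (by positivity), zero_mul]
    · rw [wtau_eq_antiGlue (arg2_mem x)]
  have hK := Ktau_eq (τ := τ) hM
  simp only [Atau, hK]
  generalize M ^ (-(1 - τ) / 2) = κ at *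
  generalize M ^ (1 - 2 * τ) = m at *
  generalize M ^ τ = N at *
  generalize muM M τ = μ at *
  generalize cM M τ = c at *
  set s := c * π / 2 with hs
  set α := μ / c with hα
  have hα0 : 0 < α := div_pos hμ hc0
  have hs0 : 0 < s := by positivity
  have hsπ : s < π := by nlinarith
  set p : ℝ → ℝ := fun θ => Real.sin (μ * (θ / c - π / 4)) with hp
  set q : ℝ → ℝ := fun θ => κ * Real.cos (μ * (N * (θ - s) / c - π / 4)) with hq
  set p' : ℝ → ℝ := fun θ => α * Real.cos (μ * (θ / c - π / 4)) with hp'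
  set q' : ℝ → ℝ := fun θ => -(κ * α * N) * Real.sin (μ * (N * (θ - s) / c - π / 4)) with hq'
  have hlin (θ : ℝ) : HasDerivAt (fun θ : ℝ => μ * (θ / c - π / 4)) α θ := by
    refine ((((hasDerivAt_id θ).div_const c).sub_const (π / 4)).const_mul μ).congr_deriv ?_
    rw [hα]
    ring
  have hlin' (θ : ℝ) : HasDerivAt (fun θ : ℝ => μ * (N * (θ - s) / c - π / 4)) (α * N) θ := by
    refine (((((hasDerivAt_id θ).sub_const s).const_mul N).div_const c).sub_const
      (π / 4)).const_mul μ |>.congr_deriv ?_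
    rw [hα]
    ring
  have hpd (θ : ℝ) : HasDerivAt p (p' θ) θ := by
    refine (hlin θ).sin.congr_deriv ?_
    simp only [hp']
    ring
  have hqd (θ : ℝ) : HasDerivAt q (q' θ) θ := by
    refine ((hlin' θ).cos.const_mul κ).congr_deriv ?_
    simp only [hq']
    ring
  have hpd' (θ : ℝ) : HasDerivAt p' (-α ^ 2 * p θ) θ := by
    refine ((hlin θ).cos.const_mul α).congr_deriv ?_
    simp only [hp]
    ring
  have hqd' (θ : ℝ) : HasDerivAt (fun θ => m * q' θ) (-α ^ 2 * (M * q θ)) θ := by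
    refine (((hlin' θ).sin.const_mul (-(κ * α * N))).const_mul m).congr_deriv ?_
    simp only [hq]
    rw [← hmN]
    ring
  have hpc : Continuous p := continuous_iff_continuousAt.2 fun θ => (hpd θ).continuousAt
  have hqc : Continuous q := continuous_iff_continuousAt.2 fun θ => (hqd θ).continuousAt
  have hpc' : Continuous p' := continuous_iff_continuousAt.2 fun θ => (hpd' θ).continuousAt
  have hmqc' : Continuous fun θ => m * q' θ :=
    continuous_iff_continuousAt.2 fun θ => (hqd' θ).continuousAt
  have hqc' : Continuous q' := by fun_prop
  have e1 : μ * (s / c - π / 4) = μ * (π / 4) := by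
    rw [hs]
    field_simp
    ring
  have e2 : μ * (N * (s - s) / c - π / 4) = -(μ * (π / 4)) := by ring
  have e3 : μ * (0 / c - π / 4) = -(μ * (π / 4)) := by ring
  have e4 : μ * (N * (π - s) / c - π / 4) = μ * (π / 4) := by
    rw [hend]
    ring
  have j1 : p s = q s := by simp only [hp, hq, e1, e2, Real.cos_neg, hsc]
  have j2 : q π = -p 0 := by simp only [hp, hq, e3, e4, Real.sin_neg, hsc, neg_neg]
  have j3 : p' s = m * q' s := by
    simp only [hp', hq', e1, e2, Real.sin_neg, hsc]
    linear_combination (-α * Real.cos (μ * (π / 4))) * hmκ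
  have j4 : m * q' π = -p' 0 := by
    simp only [hp', hq', e3, e4, Real.cos_neg, hsc]
    linear_combination (-α * Real.cos (μ * (π / 4))) * hmκ
  set C : ℝ := 1 + κ + α + κ * α * N + α * (1 + M * κ) + m * (κ * α * N)
    + α ^ 2 * (1 + M * κ) with hC
  have hpC (θ : ℝ) : |p θ| ≤ 1 := Real.abs_sin_le_one _
  have hqC (θ : ℝ) : |q θ| ≤ κ := by
    rw [hq, abs_mul, abs_of_pos hκ0]
    exact mul_le_of_le_one_right hκ0.le (Real.abs_cos_le_one _)
  have hpC' (θ : ℝ) : |p' θ| ≤ α := by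
    rw [hp', abs_mul, abs_of_pos hα0]
    exact mul_le_of_le_one_right hα0.le (Real.abs_cos_le_one _)
  have hqC' (θ : ℝ) : |q' θ| ≤ κ * α * N := by
    rw [hq', abs_mul, abs_neg, abs_of_pos (by positivity)]
    exact mul_le_of_le_one_right (by positivity) (Real.abs_sin_le_one _)
  have hMqC (θ : ℝ) : |M * q θ| ≤ M * κ := by
    rw [abs_mul, abs_of_pos hM0]
    exact mul_le_mul_of_nonneg_left (hqC θ) hM0.le
  have hmqC' (θ : ℝ) : |m * q' θ| ≤ m * (κ * α * N) := by
    rw [abs_mul, abs_of_pos hm0]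
    exact mul_le_mul_of_nonneg_left (hqC' θ) hm0.le
  have hterms : 0 < κ * α * N ∧ 0 < M * κ ∧ 0 < α * (1 + M * κ) ∧ 0 < m * (κ * α * N)
      ∧ 0 < α ^ 2 * (1 + M * κ) := by
    refine ⟨?_, ?_, ?_, ?_, ?_⟩ <;> positivity
  obtain ⟨t1, t2, t3, t4, t5⟩ := hterms
  set W := antiGlue s p q with hW
  set W' := antiGlue s p' q' with hW'
  have hWc : Continuous W := continuous_antiGlue hpc hqc hs0 hsπ j1 j2
  have hWm' : Measurable W' := measurable_antiGlue hpc'.measurable hqc'.measurable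
  have hWC : ∀ θ, |W θ| ≤ C := abs_antiGlue_le (fun θ => (hpC θ).trans (by linarith))
    fun θ => (hqC θ).trans (by linarith)
  have hWC' : ∀ θ, |W' θ| ≤ C := abs_antiGlue_le (fun θ => (hpC' θ).trans (by linarith))
    fun θ => (hqC' θ).trans (by linarith)
  have hS : ({s, π, π + s} : Set ℝ).Countable := (Set.toFinite _).countable
  refine ⟨polarGrad α W W', ?_, ?_, ?_, ?_⟩
  · refine integrableOn_ball_of_abs_le_norm_rpow (C := C ^ 2) (γ := 2 * α) ?_ (by linarith)
      fun x => ?_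
    · simp only [hu]
      exact ((measurable_norm.pow_const _).mul (hWc.measurable.comp measurable_arg2)).pow_const 2
    · have h1 := sq_le_sq' (abs_le.1 (hWC (arg2 x))).1 (abs_le.1 (hWC (arg2 x))).2
      have hr : ‖x‖ ^ (2 * α) = (‖x‖ ^ α) ^ 2 := by
        rw [← Real.rpow_mul_natCast (norm_nonneg x)]
        congr 1
        push_cast
        ring
      rw [hu, abs_of_nonneg (by positivity), mul_pow, hr, mul_comm]
      gcongr
  · exact integrableOn_dot2_polarGrad hα0 hWc.measurable hWm' hWC hWC'
  · intro φ hφ hc hsupp i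
    rw [setIntegral_eq_integral_of_forall_compl_eq_zero fun x hx => by
        rw [gradf_eq_zero_of_notMem_tsupport fun h => hx (hsupp h), Pi.zero_apply, mul_zero],
      setIntegral_eq_integral_of_forall_compl_eq_zero fun x hx => by
        rw [image_eq_zero_of_notMem_tsupport fun h => hx (hsupp h), mul_zero]]
    simp only [hu]
    exact integral_polar_mul_gradf hα0 hWc hWm' hWC hWC' (antiGlue_two_pi hs0 hsπ j2) hS
      (fun θ hθ => hasDerivAt_antiGlue hpd hqd hθ) hφ hc i
  · intro φ hφ hc hsupp
    rw [setIntegral_eq_integral_of_forall_compl_eq_zero fun x hx => by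
      simp [gradf_eq_zero_of_notMem_tsupport fun h => hx (hsupp h), dot2]]
    have key := integral_polarField_mul_fderiv
      (a := antiGlue s (fun θ => α * p θ) (fun θ => α * (M * q θ)))
      (b := antiGlue s p' (fun θ => m * q' θ))
      (b' := antiGlue s (fun θ => -α ^ 2 * p θ) (fun θ => -α ^ 2 * (M * q θ)))
      (β := α - 1) (C := C) (by linarith)
      (measurable_antiGlue (hpc.const_mul α).measurable ((hqc.const_mul M).const_mul α).measurable)
      (continuous_antiGlue hpc' hmqc' hs0 hsπ j3 j4)
      (measurable_antiGlue (hpc.const_mul _).measurable ((hqc.const_mul M).const_mul _).measurable)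
      (abs_antiGlue_le
        (fun θ => by
          rw [abs_mul, abs_of_pos hα0]
          nlinarith [hpC θ])
        (fun θ => by
          rw [abs_mul, abs_of_pos hα0]
          nlinarith [hMqC θ]))
      (abs_antiGlue_le (fun θ => (hpC' θ).trans (by linarith))
        fun θ => (hmqC' θ).trans (by linarith))
      (abs_antiGlue_le
        (fun θ => by
          rw [abs_mul, abs_neg, abs_of_pos (by positivity)]
          nlinarith [hpC θ, sq_nonneg α])
        (fun θ => by
          rw [abs_mul, abs_neg, abs_of_pos (by positivity)]
          nlinarith [hMqC θ, sq_nonneg α]))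
      (antiGlue_two_pi hs0 hsπ j4) hS (fun θ hθ => hasDerivAt_antiGlue hpd' hqd' hθ) hφ hc
    have hdiv (θ : ℝ) : (α - 1 + 1) * antiGlue s (fun θ => α * p θ) (fun θ => α * (M * q θ)) θ
        + antiGlue s (fun θ => -α ^ 2 * p θ) (fun θ => -α ^ 2 * (M * q θ)) θ = 0 := by
      unfold antiGlue
      split_ifs <;> ring
    simp only [hdiv, mul_zero, zero_mul, integral_zero, neg_zero] at key
    rw [← key]
    congr 1
    funext x
    have hg : polarGrad α W W' x = fun i => (‖x‖ ^ (α - 1) * (α * W (arg2 x))) * eit (arg2 x) i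
        + (‖x‖ ^ (α - 1) * W' (arg2 x)) * eitPerp (arg2 x) i := by
      funext i
      simp only [polarGrad]
      ring
    rw [hg, dot2_rotated_diagonal, hW, hW']
    unfold antiGlue
    split_ifs <;> ring
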